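/- arXiv:2102.04168 — 2 statements merged into one kernel-verified Lean document; each statement's English description precedes it below -/
import Mathlib

section
/- Let d ≥ 1, let H be a real symmetric d×d matrix, and let u, v be independent standard Gaussian random vectors in ℝ^d. Let c₁ > 0 and κ₂ > 0 be real numbers satisfying κ₂ ≥ 640·√2·c₁. Then min( c₁², ‖H‖_F² ) ≤ 2·E[ min( κ₂², (uᵀ H v)² ) ], where ‖H‖_F = √(∑_{i,j} H_{ij}²) is the Frobenius norm and the expectation is over the joint law of (u, v). -/
open MeasureTheory ProbabilityTheory Matrix

lemma iteratedDeriv_mgf_gaussianReal_zero_mean (v : NNReal) :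
    iteratedDeriv 2 (mgf id (gaussianReal 0 v)) 0 = v ∧
      iteratedDeriv 4 (mgf id (gaussianReal 0 v)) 0 = 3 * (v : ℝ) ^ 2 := by
  have hbase (t : ℝ) : HasDerivAt (fun t : ℝ ↦ Real.exp (v * t ^ 2 / 2))
      (Real.exp (v * t ^ 2 / 2) * (v * t)) t := by
    convert! (((hasDerivAt_id t).pow 2).const_mul (v : ℝ)).div_const 2 |>.exp using 1
    simp
    ring
  have hstep (p : ℝ → ℝ) (p' : ℝ → ℝ) (hp : ∀ t, HasDerivAt p (p' t) t) :
      deriv (fun t : ℝ ↦ p t * Real.exp (v * t ^ 2 / 2)) =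
        fun t ↦ (p' t + v * t * p t) * Real.exp (v * t ^ 2 / 2) := by
    ext t
    refine ((hp t).mul (hbase t)).deriv.trans ?_
    ring
  have h0 : mgf id (gaussianReal 0 v) = fun t : ℝ ↦ 1 * Real.exp (v * t ^ 2 / 2) := by
    rw [mgf_id_gaussianReal]
    simp
  have h1 := hstep (fun _ ↦ 1) (fun _ ↦ 0) (fun t ↦ hasDerivAt_const t 1)
  have h2 := hstep (fun t ↦ 0 + v * t * 1) (fun _ ↦ v) (fun t ↦ by
    simpa using (hasDerivAt_id t).const_mul (v : ℝ))
  have h3 := hstep (fun t ↦ v + v * t * (0 + v * t * 1)) (fun t ↦ 2 * v ^ 2 * t) (fun t ↦ by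
    convert! (((hasDerivAt_id t).pow 2).const_mul ((v : ℝ) ^ 2)).const_add (v : ℝ) using 1
    · ext t
      simp
      ring
    · simp
      ring)
  have h4 := hstep (fun t ↦ 2 * v ^ 2 * t + v * t * (v + v * t * (0 + v * t * 1)))
    (fun t ↦ 3 * v ^ 2 + 3 * v ^ 3 * t ^ 2) (fun t ↦ by
    convert! ((hasDerivAt_id t).const_mul (3 * (v : ℝ) ^ 2)).add
      (((hasDerivAt_id t).pow 3).const_mul ((v : ℝ) ^ 3)) using 1
    · ext t
      simp
      ring
    · simp
      ring)
  simp only [iteratedDeriv_succ, iteratedDeriv_zero]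
  rw [h0, h1, h2, h3, h4]
  simp

lemma integrable_pow_gaussianReal (v : NNReal) (n : ℕ) :
    Integrable (fun x : ℝ ↦ x ^ n) (gaussianReal 0 v) := by
  refine integrable_pow_of_mem_interior_integrableExpSet (X := fun x ↦ x) ?_ n
  simp

lemma integral_pow_gaussianReal_eq_iteratedDeriv (v : NNReal) (n : ℕ) :
    ∫ x, x ^ n ∂gaussianReal 0 v = iteratedDeriv n (mgf id (gaussianReal 0 v)) 0 := by
  rw [iteratedDeriv_mgf_zero (by simp)]
  simp

lemma map_dotProduct_pi_gaussianReal {ι : Type*} [Fintype ι] (a : ι → ℝ) :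
    (Measure.pi fun _ : ι ↦ gaussianReal 0 1).map (fun u ↦ u ⬝ᵥ a) =
      gaussianReal 0 (∑ i, a i ^ 2).toNNReal := by
  have hm : Measurable fun u : ι → ℝ ↦ u ⬝ᵥ a := by unfold dotProduct; fun_prop
  have : IsProbabilityMeasure ((Measure.pi fun _ : ι ↦ gaussianReal 0 1).map (fun u ↦ u ⬝ᵥ a)) :=
    Measure.isProbabilityMeasure_map hm.aemeasurable
  refine Measure.ext_of_charFun (funext fun t ↦ ?_)
  rw [charFun_apply_real, integral_map hm.aemeasurable (by fun_prop), charFun_gaussianReal]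
  calc (∫ u : ι → ℝ, Complex.exp (t * ((u ⬝ᵥ a : ℝ) : ℂ) * Complex.I)
        ∂(Measure.pi fun _ ↦ gaussianReal 0 1))
      = ∫ u : ι → ℝ, ∏ i, Complex.exp (((t * a i : ℝ) : ℂ) * u i * Complex.I)
        ∂(Measure.pi fun _ ↦ gaussianReal 0 1) := by
        congr with u
        rw [← Complex.exp_sum, ← Finset.sum_mul]
        simp only [dotProduct, Complex.ofReal_sum, Complex.ofReal_mul, Finset.mul_sum]
        congr! 3
        ring
    _ = ∏ i, charFun (gaussianReal 0 1) (t * a i) := by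
        simp_rw [charFun_apply_real]
        exact integral_fintype_prod_eq_prod
          (fun i x ↦ Complex.exp (((t * a i : ℝ) : ℂ) * (x : ℝ) * Complex.I))
    _ = _ := by
        simp_rw [charFun_gaussianReal]
        rw [← Complex.exp_sum, Real.coe_toNNReal _ (Finset.sum_nonneg fun i _ ↦ sq_nonneg _)]
        congr 1
        push_cast
        rw [Finset.sum_mul, Finset.sum_div, mul_zero, zero_mul, zero_sub, ← Finset.sum_neg_distrib]
        refine Finset.sum_congr rfl fun i _ ↦ ?_
        ring

section LinearForm

variable {ι : Type*} [Fintype ι] (a : ι → ℝ)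

lemma integrable_dotProduct_pow_pi_gaussianReal (n : ℕ) :
    Integrable (fun u : ι → ℝ ↦ (u ⬝ᵥ a) ^ n) (Measure.pi fun _ : ι ↦ gaussianReal 0 1) := by
  have hm : Measurable fun u : ι → ℝ ↦ u ⬝ᵥ a := by unfold dotProduct; fun_prop
  have h := integrable_pow_gaussianReal (∑ i, a i ^ 2).toNNReal n
  rw [← map_dotProduct_pi_gaussianReal] at h
  exact h.comp_measurable hm

lemma integral_dotProduct_pow_pi_gaussianReal (n : ℕ) :
    ∫ u : ι → ℝ, (u ⬝ᵥ a) ^ n ∂(Measure.pi fun _ : ι ↦ gaussianReal 0 1) =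
      ∫ x, x ^ n ∂gaussianReal 0 (∑ i, a i ^ 2).toNNReal := by
  have hm : Measurable fun u : ι → ℝ ↦ u ⬝ᵥ a := by unfold dotProduct; fun_prop
  rw [← map_dotProduct_pi_gaussianReal, integral_map hm.aemeasurable (by fun_prop)]

lemma integral_dotProduct_sq_pi_gaussianReal :
    ∫ u : ι → ℝ, (u ⬝ᵥ a) ^ 2 ∂(Measure.pi fun _ : ι ↦ gaussianReal 0 1) = ∑ i, a i ^ 2 := by
  rw [integral_dotProduct_pow_pi_gaussianReal, integral_pow_gaussianReal_eq_iteratedDeriv,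
    (iteratedDeriv_mgf_gaussianReal_zero_mean _).1,
    Real.coe_toNNReal _ (Finset.sum_nonneg fun i _ ↦ sq_nonneg _)]

lemma integral_dotProduct_pow_four_pi_gaussianReal :
    ∫ u : ι → ℝ, (u ⬝ᵥ a) ^ 4 ∂(Measure.pi fun _ : ι ↦ gaussianReal 0 1) =
      3 * (∑ i, a i ^ 2) ^ 2 := by
  rw [integral_dotProduct_pow_pi_gaussianReal, integral_pow_gaussianReal_eq_iteratedDeriv,
    (iteratedDeriv_mgf_gaussianReal_zero_mean _).2,
    Real.coe_toNNReal _ (Finset.sum_nonneg fun i _ ↦ sq_nonneg _)]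

end LinearForm

lemma mulVec_apply_eq_zero_of_sum_sq_eq_zero {ι κ : Type*} [Fintype κ] {H : Matrix ι κ ℝ} {i : ι}
    (hi : ∑ j, H i j ^ 2 = 0) (v : κ → ℝ) : (H *ᵥ v) i = 0 := by
  rw [Finset.sum_eq_zero_iff_of_nonneg fun j _ ↦ sq_nonneg _] at hi
  refine Finset.sum_eq_zero fun j hj ↦ ?_
  exact mul_eq_zero_of_left (pow_eq_zero_iff two_ne_zero |>.1 (hi j hj)) _

lemma integrable_mulVec_pow {ι κ : Type*} [Fintype κ] (H : Matrix ι κ ℝ) (i : ι) (n : ℕ) :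
    Integrable (fun v : κ → ℝ ↦ (H *ᵥ v) i ^ n) (Measure.pi fun _ : κ ↦ gaussianReal 0 1) := by
  simpa only [mulVec, dotProduct_comm] using integrable_dotProduct_pow_pi_gaussianReal (H i) n

section BilinearForm

variable {ι κ : Type*} [Fintype ι] [Fintype κ] (H : Matrix ι κ ℝ)

lemma sum_sq_mulVec_sq_le (v : κ → ℝ) :
    (∑ i, (H *ᵥ v) i ^ 2) ^ 2 ≤
      (∑ i, ∑ j, H i j ^ 2) * ∑ i, (H *ᵥ v) i ^ 4 / ∑ j, H i j ^ 2 := by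
  refine Finset.sum_sq_le_sum_mul_sum_of_sq_le_mul _
    (fun i _ ↦ Finset.sum_nonneg fun j _ ↦ sq_nonneg _) (fun i _ ↦ by positivity) fun i _ ↦ ?_
  refine le_of_eq ?_
  by_cases hi : ∑ j, H i j ^ 2 = 0
  · simp [hi, mulVec_apply_eq_zero_of_sum_sq_eq_zero hi v]
  · field_simp

lemma integral_sum_sq_mulVec :
    ∫ v : κ → ℝ, ∑ i, (H *ᵥ v) i ^ 2 ∂(Measure.pi fun _ : κ ↦ gaussianReal 0 1) =
      ∑ i, ∑ j, H i j ^ 2 := by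
  rw [integral_finsetSum _ fun i _ ↦ integrable_mulVec_pow H i 2]
  refine Finset.sum_congr rfl fun i _ ↦ ?_
  simpa only [mulVec, dotProduct_comm] using integral_dotProduct_sq_pi_gaussianReal (H i)

lemma integrable_sum_pow_four_mulVec_div :
    Integrable (fun v : κ → ℝ ↦
      (∑ i, ∑ j, H i j ^ 2) * ∑ i, (H *ᵥ v) i ^ 4 / ∑ j, H i j ^ 2)
      (Measure.pi fun _ : κ ↦ gaussianReal 0 1) :=
  (integrable_finsetSum _ fun i _ ↦ (integrable_mulVec_pow H i 4).div_const _).const_mul _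

lemma integrable_sum_sq_mulVec_sq :
    Integrable (fun v : κ → ℝ ↦ (∑ i, (H *ᵥ v) i ^ 2) ^ 2)
      (Measure.pi fun _ : κ ↦ gaussianReal 0 1) := by
  refine (integrable_sum_pow_four_mulVec_div H).mono' ?_ (.of_forall fun v ↦ ?_)
  · have (i : ι) : Measurable fun v : κ → ℝ ↦ (H *ᵥ v) i := by
      simp only [mulVec, dotProduct]
      fun_prop
    fun_prop
  · rw [Real.norm_of_nonneg (sq_nonneg _)]
    exact sum_sq_mulVec_sq_le H v

lemma integral_sum_sq_mulVec_sq_le :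
    ∫ v : κ → ℝ, (∑ i, (H *ᵥ v) i ^ 2) ^ 2 ∂(Measure.pi fun _ : κ ↦ gaussianReal 0 1) ≤
      3 * (∑ i, ∑ j, H i j ^ 2) ^ 2 := by
  have hrow (i : ι) : ∫ v : κ → ℝ, (H *ᵥ v) i ^ 4 ∂(Measure.pi fun _ : κ ↦ gaussianReal 0 1) =
      3 * (∑ j, H i j ^ 2) ^ 2 := by
    simpa only [mulVec, dotProduct_comm] using integral_dotProduct_pow_four_pi_gaussianReal (H i)
  refine (integral_mono (integrable_sum_sq_mulVec_sq H) (integrable_sum_pow_four_mulVec_div H)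
    (sum_sq_mulVec_sq_le H)).trans_eq ?_
  rw [integral_const_mul,
    integral_finsetSum _ fun i _ ↦ (integrable_mulVec_pow H i 4).div_const _]
  simp_rw [integral_div, hrow, mul_div_assoc, pow_two (∑ j, H _ j ^ 2), mul_self_div_self,
    ← Finset.mul_sum]
  ring

lemma measurable_bilinear :
    Measurable fun p : (ι → ℝ) × (κ → ℝ) ↦ p.1 ⬝ᵥ H *ᵥ p.2 := by
  simp only [mulVec, dotProduct]
  fun_prop

lemma integrable_bilinear_pow_four :
    Integrable (fun p : (ι → ℝ) × (κ → ℝ) ↦ (p.1 ⬝ᵥ H *ᵥ p.2) ^ 4)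
      ((Measure.pi fun _ : ι ↦ gaussianReal 0 1).prod
        (Measure.pi fun _ : κ ↦ gaussianReal 0 1)) := by
  rw [integrable_prod_iff' ((measurable_bilinear H).pow_const 4).aestronglyMeasurable]
  refine ⟨.of_forall fun v ↦ integrable_dotProduct_pow_pi_gaussianReal (H *ᵥ v) 4, ?_⟩
  simp only [Real.norm_eq_abs, Even.pow_abs (show Even 4 by decide), abs_pow,
    integral_dotProduct_pow_four_pi_gaussianReal]
  exact (integrable_sum_sq_mulVec_sq H).const_mul 3

lemma integrable_bilinear_sq :
    Integrable (fun p : (ι → ℝ) × (κ → ℝ) ↦ (p.1 ⬝ᵥ H *ᵥ p.2) ^ 2)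
      ((Measure.pi fun _ : ι ↦ gaussianReal 0 1).prod
        (Measure.pi fun _ : κ ↦ gaussianReal 0 1)) := by
  refine ((integrable_bilinear_pow_four H).add (integrable_const 1)).mono'
    ((measurable_bilinear H).pow_const 2).aestronglyMeasurable (.of_forall fun p ↦ ?_)
  rw [Real.norm_of_nonneg (sq_nonneg _), Pi.add_apply]
  nlinarith [sq_nonneg ((p.1 ⬝ᵥ H *ᵥ p.2) ^ 2 - 1)]

lemma integral_bilinear_sq :
    ∫ p : (ι → ℝ) × (κ → ℝ), (p.1 ⬝ᵥ H *ᵥ p.2) ^ 2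
      ∂((Measure.pi fun _ : ι ↦ gaussianReal 0 1).prod
        (Measure.pi fun _ : κ ↦ gaussianReal 0 1)) = ∑ i, ∑ j, H i j ^ 2 := by
  rw [integral_prod_symm _ (integrable_bilinear_sq H)]
  simp_rw [integral_dotProduct_sq_pi_gaussianReal]
  exact integral_sum_sq_mulVec H

lemma integral_bilinear_pow_four_le :
    ∫ p : (ι → ℝ) × (κ → ℝ), (p.1 ⬝ᵥ H *ᵥ p.2) ^ 4
      ∂((Measure.pi fun _ : ι ↦ gaussianReal 0 1).prod
        (Measure.pi fun _ : κ ↦ gaussianReal 0 1)) ≤ 9 * (∑ i, ∑ j, H i j ^ 2) ^ 2 := by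
  rw [integral_prod_symm _ (integrable_bilinear_pow_four H)]
  simp_rw [integral_dotProduct_pow_four_pi_gaussianReal]
  rw [integral_const_mul]
  linarith [integral_sum_sq_mulVec_sq_le H]

end BilinearForm

lemma mul_sub_sq_div_le_min {K t x : ℝ} (hK : 0 < K) (ht : t ≤ 1) (hx : 0 ≤ x) :
    t * x - t ^ 2 / (4 * K) * x ^ 2 ≤ min K x := by
  refine le_min ?_ ?_
  · have : K - (t * x - t ^ 2 / (4 * K) * x ^ 2) = (t * x - 2 * K) ^ 2 / (4 * K) := by
      field_simp
      ring
    have : 0 ≤ (t * x - 2 * K) ^ 2 / (4 * K) := by positivity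
    linarith
  · have : 0 ≤ t ^ 2 / (4 * K) * x ^ 2 := by positivity
    nlinarith

/-- **Clipped second-moment lower bound (Lemma C.6 / `lem:concentration-matrix-min`).**
For a symmetric `d × d` matrix `H`, independent standard Gaussian vectors `u, v` in `ℝ^d`,
and reals `c₁, κ₂ > 0` with `κ₂ ≥ 640√2 c₁`, one has
`min(c₁², ‖H‖_F²) ≤ 2 E[min(κ₂², (uᵀHv)²)]`. -/
theorem clipped_bilinear_moment
    {d : ℕ} (hd : 1 ≤ d) (H : Matrix (Fin d) (Fin d) ℝ) (hH : H.IsSymm)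
    (c₁ κ₂ : ℝ) (hc₁ : 0 < c₁) (hκ₂ : 0 < κ₂) (hκc : 640 * Real.sqrt 2 * c₁ ≤ κ₂) :
    min (c₁ ^ 2) (∑ i, ∑ j, H i j ^ 2) ≤
      2 * ∫ p : (Fin d → ℝ) × (Fin d → ℝ),
        min (κ₂ ^ 2) ((p.1 ⬝ᵥ H.mulVec p.2) ^ 2)
        ∂((Measure.pi fun _ : Fin d => gaussianReal 0 1).prod
            (Measure.pi fun _ : Fin d => gaussianReal 0 1)) := by
  set F := ∑ i, ∑ j, H i j ^ 2 with hF
  set P := (Measure.pi fun _ : Fin d => gaussianReal 0 1).prod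
    (Measure.pi fun _ : Fin d => gaussianReal 0 1)
  have hF0 : 0 ≤ F := Finset.sum_nonneg fun i _ ↦ Finset.sum_nonneg fun j _ ↦ sq_nonneg _
  rcases hF0.eq_or_lt with h0 | hpos
  · rw [← h0, min_eq_right (sq_nonneg c₁)]
    exact mul_nonneg zero_le_two (integral_nonneg fun p ↦ le_min (sq_nonneg _) (sq_nonneg _))
  set m := min (c₁ ^ 2) F
  have hm0 : 0 ≤ m := le_min (sq_nonneg _) hF0
  have hKm : 819200 * m ≤ κ₂ ^ 2 := by
    calc 819200 * m ≤ 819200 * c₁ ^ 2 := by gcongr; exact min_le_left _ _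
      _ = (640 * Real.sqrt 2 * c₁) ^ 2 := by
        rw [mul_pow, mul_pow, Real.sq_sqrt zero_le_two]
        norm_num
      _ ≤ κ₂ ^ 2 := by gcongr
  have hK : 0 < κ₂ ^ 2 := by positivity
  set t := m / F
  have htF : t * F = m := div_mul_cancel₀ m hpos.ne'
  have ht : t ≤ 1 := (div_le_one hpos).2 (min_le_right _ _)
  have hlower : Integrable (fun p : (Fin d → ℝ) × (Fin d → ℝ) ↦
      t * (p.1 ⬝ᵥ H *ᵥ p.2) ^ 2 - t ^ 2 / (4 * κ₂ ^ 2) * (p.1 ⬝ᵥ H *ᵥ p.2) ^ 4) P :=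
    ((integrable_bilinear_sq H).const_mul _).sub ((integrable_bilinear_pow_four H).const_mul _)
  have hclip : Integrable (fun p : (Fin d → ℝ) × (Fin d → ℝ) ↦
      min (κ₂ ^ 2) ((p.1 ⬝ᵥ H *ᵥ p.2) ^ 2)) P := (integrable_const _).inf (integrable_bilinear_sq H)
  have hmono := integral_mono hlower hclip fun p ↦ by
    simpa only [← pow_mul] using mul_sub_sq_div_le_min hK ht (sq_nonneg (p.1 ⬝ᵥ H *ᵥ p.2))
  rw [integral_sub ((integrable_bilinear_sq H).const_mul _)
    ((integrable_bilinear_pow_four H).const_mul _), integral_const_mul, integral_const_mul,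
    integral_bilinear_sq, ← hF, htF] at hmono
  have hfour : t ^ 2 / (4 * κ₂ ^ 2) * ∫ p, (p.1 ⬝ᵥ H *ᵥ p.2) ^ 4 ∂P ≤ m / 2 := by
    calc t ^ 2 / (4 * κ₂ ^ 2) * ∫ p, (p.1 ⬝ᵥ H *ᵥ p.2) ^ 4 ∂P
        ≤ t ^ 2 / (4 * κ₂ ^ 2) * (9 * F ^ 2) := by
          gcongr
          exact integral_bilinear_pow_four_le H
      _ = 9 * m ^ 2 / (4 * κ₂ ^ 2) := by
          rw [← htF]
          ring
      _ ≤ m / 2 := by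
          rw [div_le_div_iff₀ (by positivity) two_pos]
          nlinarith
  linarith
end

section
/- Let σ > 0 and let P : ℝ → ℝ be the density of the one-dimensional Gaussian measure N(0, σ²), i.e. P(y) = (1/(σ·√(2π)))·exp(−y²/(2σ²)). Then for every real x ≥ 0, ∫_{0}^{∞} ( P(y − x) − P(y + x) ) · (y − x)² dy ≤ x²/σ + 4σx. -/
open MeasureTheory in
lemma setIntegral_Ioi_comp_add_right (f : ℝ → ℝ) (a d : ℝ) :
    ∫ y in Set.Ioi a, f (y + d) = ∫ y in Set.Ioi (a + d), f y := by
  rw [← (measurePreserving_add_right volume d).setIntegral_preimage_emb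
    (measurableEmbedding_addRight d) f (Set.Ioi (a + d))]
  simp

lemma integral_Ioi_mul_exp_neg_mul_sq {b : ℝ} (hb : 0 < b) :
    ∫ y in Set.Ioi (0 : ℝ), y * Real.exp (-b * y ^ 2) = (2 * b)⁻¹ := by
  have h := integral_mul_cexp_neg_mul_sq (b := (b : ℂ)) (by simpa using hb)
  have h2 : ∀ y : ℝ, (y : ℂ) * Complex.exp (-(b : ℂ) * (y : ℂ) ^ 2)
      = ((y * Real.exp (-b * y ^ 2) : ℝ) : ℂ) := fun y => by push_cast; rfl
  simp_rw [h2] at h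
  rw [integral_complex_ofReal] at h
  exact_mod_cast h

lemma sq_mul_exp_neg_mul_sq_le {b : ℝ} (hb : 0 < b) (y : ℝ) :
    y ^ 2 * Real.exp (-b * y ^ 2) ≤ b⁻¹ := by
  have h := Real.add_one_le_exp (b * y ^ 2)
  rw [neg_mul, Real.exp_neg, ← div_eq_mul_inv, div_le_iff₀ (Real.exp_pos _),
    inv_mul_eq_div, le_div_iff₀ hb]
  linarith

open MeasureTheory in
/-- **Lemma C.14, part 3 (`lem:lip-1-1dim`).**  With `P` the density of `N(0, σ²)`,
for every `x ≥ 0`, `∫_{0}^{∞} (P(y-x) - P(y+x)) (y-x)² dy ≤ x²/σ + 4σx`. -/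
theorem gaussian_shift_integral_sq
    (σ : ℝ) (hσ : 0 < σ)
    (P : ℝ → ℝ)
    (hP : ∀ y, P y = (1 / (σ * Real.sqrt (2 * Real.pi))) * Real.exp (-y ^ 2 / (2 * σ ^ 2)))
    (x : ℝ) (hx : 0 ≤ x) :
    ∫ y in Set.Ioi (0 : ℝ), (P (y - x) - P (y + x)) * (y - x) ^ 2 ≤ x ^ 2 / σ + 4 * σ * x := by
  set c := 1 / (σ * Real.sqrt (2 * Real.pi)) with hc
  set b := (2 * σ ^ 2)⁻¹ with hbdef
  have hb : 0 < b := by positivity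
  have hc0 : 0 < c := by positivity
  have hP' : ∀ y, P y = c * Real.exp (-b * y ^ 2) := fun y => by
    rw [hP, hbdef]; congr 2; field_simp
  have hcσ : 2 * c * σ ≤ 1 := by
    have hs : 2 ≤ Real.sqrt (2 * Real.pi) :=
      Real.le_sqrt_of_sq_le (by linarith [Real.pi_gt_three])
    rw [hc, show 2 * (1 / (σ * Real.sqrt (2 * Real.pi))) * σ = 2 / Real.sqrt (2 * Real.pi) by
      field_simp]
    exact (div_le_one (by linarith)).2 hs
  have hG : Integrable fun z => P z * z ^ 2 := by
    have h := (integrable_rpow_mul_exp_neg_mul_sq hb (by norm_num : (-1 : ℝ) < 2)).const_mul c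
    refine h.congr (.of_forall fun z => ?_)
    simp only [hP', Real.rpow_two]
    ring
  have hL : Integrable fun y => y * P y := by
    refine ((integrable_mul_exp_neg_mul_sq hb).const_mul c).congr (.of_forall fun z => ?_)
    simp only [hP']
    ring
  have hGsub := (hG.comp_sub_right x).integrableOn (s := Set.Ioi 0)
  have hGadd := (hG.comp_add_right x).integrableOn (s := Set.Ioi 0)
  have hLx := (hL.const_mul (4 * x)).integrableOn (s := Set.Ioi 0)
  have hanti : ∀ y ∈ Set.Ioi (0 : ℝ), P (y + x) ≤ P y := fun y hy => by
    have hy : 0 < y := hy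
    rw [hP', hP']
    gcongr ?_ * Real.exp ?_
    nlinarith [mul_nonneg hb.le (by positivity : 0 ≤ 2 * y * x + x ^ 2)]
  have hdiff : (∫ y in Set.Ioi (0 : ℝ), P (y - x) * (y - x) ^ 2)
      - ∫ y in Set.Ioi (0 : ℝ), P (y + x) * (y + x) ^ 2 ≤ c * b⁻¹ * (2 * x) := by
    have h₁ := setIntegral_Ioi_comp_add_right (fun z => P z * z ^ 2) 0 (-x)
    have h₂ := setIntegral_Ioi_comp_add_right (fun z => P z * z ^ 2) 0 x
    simp only [← sub_eq_add_neg] at h₁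
    rw [h₁, h₂, intervalIntegral.integral_Ioi_sub_Ioi hG.integrableOn (by linarith)]
    refine (Real.le_norm_self _).trans ((intervalIntegral.norm_integral_le_of_norm_le_const
      (C := c * b⁻¹) fun z _ => ?_).trans_eq ?_)
    · rw [hP', Real.norm_of_nonneg (by positivity), mul_assoc, mul_comm (Real.exp _)]
      exact mul_le_mul_of_nonneg_left (sq_mul_exp_neg_mul_sq_le hb z) hc0.le
    · rw [abs_of_nonneg (by linarith)]
      ring
  have hlin : ∫ y in Set.Ioi (0 : ℝ), 4 * x * (y * P y) = 4 * x * (c * (2 * b)⁻¹) := by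
    rw [← integral_Ioi_mul_exp_neg_mul_sq hb, ← integral_const_mul, ← integral_const_mul]
    refine integral_congr_ae (.of_forall fun y => ?_)
    simp only [hP']
    ring
  calc ∫ y in Set.Ioi (0 : ℝ), (P (y - x) - P (y + x)) * (y - x) ^ 2
      ≤ ∫ y in Set.Ioi (0 : ℝ), (P (y - x) * (y - x) ^ 2 - P (y + x) * (y + x) ^ 2
          + 4 * x * (y * P y)) := by
        refine setIntegral_mono_on ?_ ((hGsub.sub hGadd).add hLx) measurableSet_Ioi
          fun y hy => ?_
        · have hfirst : Integrable fun y => (y + x) * P (y + x) := hL.comp_add_right x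
          have hzero : Integrable fun y => P (y + x) := by
            refine (((integrable_exp_neg_mul_sq hb).const_mul c).comp_add_right x).congr
              (.of_forall fun y => ?_)
            simp only [hP']
          refine ((hGsub.sub hGadd).add ((hfirst.const_mul (4 * x)).sub
            (hzero.const_mul (4 * x ^ 2))).integrableOn).congr (.of_forall fun y => ?_)
          simp only [Pi.add_apply, Pi.sub_apply]
          ring
        · have hy0 : 0 < y := hy
          have := mul_le_mul_of_nonneg_left (hanti y hy) (by positivity : 0 ≤ 4 * x * y)
          linarith
    _ ≤ c * b⁻¹ * (2 * x) + 4 * x * (c * (2 * b)⁻¹) := by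
        refine (integral_add (hGsub.sub hGadd) hLx).trans_le ?_
        rw [hlin]
        exact add_le_add_left ((integral_sub hGsub hGadd).trans_le hdiff) _
    _ = 4 * σ * x * (2 * c * σ) := by
        rw [mul_inv, hbdef, inv_inv]
        ring
    _ ≤ 4 * σ * x := mul_le_of_le_one_right (by positivity) hcσ
    _ ≤ x ^ 2 / σ + 4 * σ * x := le_add_of_nonneg_left (by positivity)
end
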